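/- Let β=αΔ ∈ (0,1), let γ_b(y)=Γ(b)^{-1}y^{b−1}e^{-y}1_{(0,∞)}(y) denote the Gamma(b,1) density (extended by 0 for y≤0) and Γ_b its cumulative distribution function. Then for every t>0, the integral ∫_0^∞ (1 − Γ_{1−β}(t−x) − γ_{1−β}(t−x))² γ_{β}(x) dx is finite if and only if β < 1/2. (This integral is the asymptotic variance Σ_{t,t} of the estimator for a Gamma process with λ=1; the integrand has poles of order 2(1−β)·… at x=t and of order 1−β at x=0, and finiteness fails when β ≥ 1/2.) -/

import Mathlib

open MeasureTheory Filter Topology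
open scoped ENNReal Real

noncomputable section

/-- The `Gamma(b,1)` probability density, extended by `0` on `(-∞,0]`. -/
def gammaPdf (b y : ℝ) : ℝ := if 0 < y then y ^ (b - 1) * Real.exp (-y) / Real.Gamma b else 0

/-- The `Gamma(b,1)` cumulative distribution function. -/
def gammaCdf (b y : ℝ) : ℝ := ∫ z in Set.Iic y, gammaPdf b z

lemma gp_nonneg {b : ℝ} (hb : 0 < b) (y : ℝ) : 0 ≤ gammaPdf b y := by
  unfold gammaPdf
  have := Real.Gamma_pos_of_pos hb
  split_ifs with h
  · positivity
  · exact le_rfl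

lemma gp_meas (b : ℝ) : Measurable (gammaPdf b) := by
  unfold gammaPdf
  refine Measurable.ite measurableSet_Ioi ?_ measurable_const
  fun_prop

lemma gp_eq_ind (b : ℝ) : gammaPdf b =
    (Set.Ioi (0:ℝ)).indicator (fun y => Real.exp (-y) * y ^ (b - 1) / Real.Gamma b) := by
  ext y
  by_cases h : 0 < y
  · simp [gammaPdf, h, mul_comm]
  · simp [gammaPdf, h]

lemma gp_int {b : ℝ} (hb : 0 < b) : Integrable (gammaPdf b) := by
  rw [gp_eq_ind, integrable_indicator_iff measurableSet_Ioi]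
  exact (Real.GammaIntegral_convergent hb).div_const _

lemma gp_total {b : ℝ} (hb : 0 < b) : ∫ y, gammaPdf b y = 1 := by
  rw [gp_eq_ind, integral_indicator measurableSet_Ioi, integral_div, ← Real.Gamma_eq_integral hb]
  exact div_self (Real.Gamma_pos_of_pos hb).ne'

lemma gc_nonneg {b : ℝ} (hb : 0 < b) (y : ℝ) : 0 ≤ gammaCdf b y :=
  integral_nonneg fun z => gp_nonneg hb z

lemma gc_le {b : ℝ} (hb : 0 < b) (y : ℝ) : gammaCdf b y ≤ 1 := by
  rw [← gp_total hb]
  exact setIntegral_le_integral (gp_int hb) (ae_of_all _ (gp_nonneg hb))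

lemma gc_mono {b : ℝ} (hb : 0 < b) : Monotone (gammaCdf b) := by
  intro x y h
  exact setIntegral_mono_set (gp_int hb).integrableOn (ae_of_all _ (gp_nonneg hb))
    (Set.Iic_subset_Iic.2 h).eventuallyLE

/-- upper bound away from zero -/
lemma gp_le {b : ℝ} (hb : 0 < b) (hb1 : b ≤ 1) {s y : ℝ} (hs : 0 < s) (hy : s ≤ y) :
    gammaPdf b y ≤ s ^ (b - 1) / Real.Gamma b := by
  have hG := Real.Gamma_pos_of_pos hb
  have hy0 : 0 < y := hs.trans_le hy
  rw [gammaPdf, if_pos hy0]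
  gcongr
  have h1 : y ^ (b - 1) ≤ s ^ (b - 1) := Real.rpow_le_rpow_of_nonpos hs hy (by linarith)
  have h2 : Real.exp (-y) ≤ 1 := Real.exp_le_one_iff.2 (by linarith)
  have h3 : 0 ≤ y ^ (b - 1) := by positivity
  nlinarith [Real.exp_pos (-y)]

/-- lower bound -/
lemma le_gp {b : ℝ} (hb : 0 < b) {s y : ℝ} (hy0 : 0 < y) (hy : y ≤ s) :
    y ^ (b - 1) * (Real.exp (-s) / Real.Gamma b) ≤ gammaPdf b y := by
  have hG := Real.Gamma_pos_of_pos hb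
  rw [gammaPdf, if_pos hy0, mul_div_assoc]
  gcongr

lemma gp_sq_int {β : ℝ} (h0 : 0 < β) (h : β < 1 / 2) :
    Integrable (fun y => gammaPdf (1 - β) y ^ 2) := by
  have hG := Real.Gamma_pos_of_pos (show 0 < 1 - β by linarith)
  have hG2 := Real.Gamma_pos_of_pos (show 0 < 1 - 2 * β by linarith)
  refine ((gp_int (show 0 < 1 - 2 * β by linarith)).const_mul
    (Real.Gamma (1 - 2 * β) / Real.Gamma (1 - β) ^ 2)).mono'
    ((gp_meas _).pow_const 2).aestronglyMeasurable (ae_of_all _ fun y => ?_)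
  rw [Real.norm_of_nonneg (sq_nonneg _)]
  unfold gammaPdf
  split_ifs with hy
  · have e : (y ^ (1 - β - 1)) ^ 2 = y ^ (1 - 2 * β - 1) := by
      rw [← Real.rpow_natCast, ← Real.rpow_mul hy.le]; congr 1; push_cast; ring
    have : Real.exp (-y) ^ 2 ≤ Real.exp (-y) := by
      have h2 : Real.exp (-y) ≤ 1 := Real.exp_le_one_iff.2 (by linarith)
      nlinarith [Real.exp_pos (-y)]
    rw [div_pow, mul_pow, e]
    have e2 : Real.Gamma (1 - 2 * β) / Real.Gamma (1 - β) ^ 2 *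
      (y ^ (1 - 2 * β - 1) * Real.exp (-y) / Real.Gamma (1 - 2 * β)) =
      y ^ (1 - 2 * β - 1) * Real.exp (-y) / Real.Gamma (1 - β) ^ 2 := by
      field_simp
    rw [e2]
    gcongr
  · simp

/-- For `β ∈ (0,1)` and every `t > 0`, the asymptotic variance integral
`∫₀^∞ (1 - Γ_{1-β}(t-x) - γ_{1-β}(t-x))² γ_β(x) dx` is finite if and only if `β < 1/2`. -/
theorem statement17 (β : ℝ) (hβ : β ∈ Set.Ioo (0 : ℝ) 1) (t : ℝ) (ht : 0 < t) :
    IntegrableOn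
      (fun x : ℝ => (1 - gammaCdf (1 - β) (t - x) - gammaPdf (1 - β) (t - x)) ^ 2 *
        gammaPdf β x)
      (Set.Ioi 0) volume ↔ β < 1 / 2 := by
  obtain ⟨h0, h1⟩ := hβ
  have h1' : 0 < 1 - β := by linarith
  have ht2 : 0 < t / 2 := by linarith
  have hG := Real.Gamma_pos_of_pos h0
  have hG' := Real.Gamma_pos_of_pos h1'
  have mp : Measurable fun x => gammaPdf (1 - β) (t - x) :=
    (gp_meas _).comp (measurable_const.sub measurable_id)
  have mc : Measurable fun x => gammaCdf (1 - β) (t - x) :=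
    (gc_mono h1').measurable.comp (measurable_const.sub measurable_id)
  have hg0 := gc_nonneg h1'
  have hg1 := gc_le h1'
  constructor
  · intro hI
    have hc : 0 < t ^ (β - 1) * (Real.exp (-t) / Real.Gamma β) := by positivity
    set c := t ^ (β - 1) * (Real.exp (-t) / Real.Gamma β) with hcdef
    have hd : 0 < Real.exp (-t) / Real.Gamma (1 - β) := by positivity
    set d := Real.exp (-t) / Real.Gamma (1 - β) with hddef
    have hI2 := hI.mono_set (show Set.Ioo 0 t ⊆ Set.Ioi 0 from fun x hx => hx.1)
    have hJ : IntegrableOn (fun x => (t - x) ^ (-(2 * β))) (Set.Ioo 0 t) := by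
      have hB := ((hI2.const_mul (2 / c)).add
        (integrableOn_const (C := (2:ℝ)) (s := Set.Ioo 0 t) (μ := volume)
          (by simp))).const_mul (1 / d ^ 2)
      refine Integrable.mono' hB
        (show Measurable fun x : ℝ => (t - x) ^ (-(2 * β)) by fun_prop).aestronglyMeasurable ?_
      refine (ae_restrict_iff' measurableSet_Ioo).2 (ae_of_all _ fun x hx => ?_)
      have hx1 : 0 < t - x := by linarith [hx.2]
      have hx0 : 0 < x := hx.1
      rw [Real.norm_of_nonneg (by positivity)]
      have hq : c ≤ gammaPdf β x := by
        refine le_trans ?_ (le_gp h0 hx0 hx.2.le)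
        rw [hcdef]
        gcongr ?_ * _
        exact Real.rpow_le_rpow_of_nonpos hx0 hx.2.le (by linarith)
      have hp := le_gp h1' (s := t) hx1 (by linarith)
      rw [← hddef] at hp
      have e : ((t - x) ^ (1 - β - 1)) ^ 2 = (t - x) ^ (-(2 * β)) := by
        rw [← Real.rpow_natCast, ← Real.rpow_mul hx1.le]; congr 1; push_cast; ring
      have hp2 : (t - x) ^ (-(2 * β)) * d ^ 2 ≤ gammaPdf (1 - β) (t - x) ^ 2 := by
        rw [← e, ← mul_pow]
        exact pow_le_pow_left₀ (by positivity) hp 2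
      have ha := hg0 (t - x)
      have hb := hg1 (t - x)
      simp only [Pi.add_apply]
      generalize gammaPdf (1 - β) (t - x) = p at *
      generalize gammaCdf (1 - β) (t - x) = g at *
      generalize gammaPdf β x = q at *
      have k1 : 2 * (1 - g - p) ^ 2 ≤ 2 / c * ((1 - g - p) ^ 2 * q) := by
        rw [div_mul_eq_mul_div, le_div_iff₀ hc]
        nlinarith [mul_le_mul_of_nonneg_left hq (sq_nonneg (1 - g - p))]
      have k2 : p ^ 2 ≤ 2 * (1 - g - p) ^ 2 + 2 := by
        nlinarith [sq_nonneg (2 * (1 - g) - p), mul_nonneg ha (sub_nonneg.2 hb)]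
      rw [one_div_mul_eq_div, le_div_iff₀ (by positivity)]
      linarith
    have hK : IntegrableOn (fun x : ℝ => x ^ (-(2 * β))) (Set.Ioo 0 t) := by
      have := (Measure.measurePreserving_sub_left volume t).integrableOn_comp_preimage
        (MeasurableEquiv.subLeft t).measurableEmbedding
        (f := fun x : ℝ => x ^ (-(2 * β))) (s := Set.Ioo 0 t)
      rw [← this]
      simpa [Function.comp_def] using hJ
    have := (intervalIntegral.integrableOn_Ioo_rpow_iff ht).1 hK
    linarith
  · intro h
    have hq := gp_int h0
    have hp := (gp_sq_int h0 h).comp_sub_left t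
    set A := ((t / 2) ^ (1 - β - 1) / Real.Gamma (1 - β)) ^ 2 with hA
    set B := (t / 2) ^ (β - 1) / Real.Gamma β with hB
    have hB0 : 0 ≤ B := by positivity
    have hA0 : 0 ≤ A := by positivity
    refine Integrable.integrableOn ?_
    refine ((hq.const_mul (2 + 2 * A)).add (hp.const_mul (2 * B))).mono' ?_
      (ae_of_all _ fun x => ?_)
    · exact ((((measurable_const.sub mc).sub mp).pow_const 2).mul (gp_meas _)).aestronglyMeasurable
    · have q0 := gp_nonneg h0 x
      have p0 := gp_nonneg h1' (t - x)
      rw [Real.norm_of_nonneg (by positivity)]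
      have ha := hg0 (t - x)
      have hb := hg1 (t - x)
      have key : gammaPdf (1 - β) (t - x) ^ 2 * gammaPdf β x ≤
          A * gammaPdf β x + B * gammaPdf (1 - β) (t - x) ^ 2 := by
        rcases le_total x (t / 2) with hx | hx
        · have := gp_le h1' (by linarith) ht2 (show t / 2 ≤ t - x by linarith)
          have h2 := mul_le_mul_of_nonneg_right (pow_le_pow_left₀ p0 this 2) q0
          rw [← hA] at h2
          have := mul_nonneg hB0 (sq_nonneg (gammaPdf (1 - β) (t - x)))
          linarith
        · have := gp_le h0 h1.le ht2 hx
          have h2 := mul_le_mul_of_nonneg_left this (sq_nonneg (gammaPdf (1 - β) (t - x)))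
          rw [← hB] at h2
          have := mul_nonneg hA0 q0
          linarith
      simp only [Pi.add_apply]
      generalize gammaPdf (1 - β) (t - x) = p at *
      generalize gammaCdf (1 - β) (t - x) = g at *
      generalize gammaPdf β x = q at *
      have k2 : (1 - g - p) ^ 2 ≤ 2 + 2 * p ^ 2 := by
        nlinarith [sq_nonneg ((1 - g) + p), mul_nonneg ha (sub_nonneg.2 hb)]
      have := mul_le_mul_of_nonneg_right k2 q0
      linarith
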